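/- Let 0 < p ≤ 1 and let f be the martingale constructed from (α_k). Then there exists an absolute constant c > 0 such that for every k ≥ 1, Σ_{l=1}^{k} M_{α_l}^{2−2/p} Φ_{M_{α_l}} Σ_{j=1}^{m_{α_l}−1} |f̂(j·M_{α_l})|^2 ≥ c · Φ_{M_{α_k}}^{1/2}; in particular, since Φ_n → ∞, Σ_{l=1}^∞ M_{α_l}^{2−2/p} Φ_{M_{α_l}} Σ_{j=1}^{m_{α_l}−1} |f̂(j·M_{α_l})|^2 = ∞. -/

import Mathlib

open MeasureTheory Filter Finset
open scoped Classical ENNReal NNReal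

noncomputable section

namespace VilenkinPaper

/-- The generalized powers `M_0 = 1`, `M_{k+1} = m_k M_k`. -/
def Mseq (m : ℕ → ℕ) : ℕ → ℕ
  | 0 => 1
  | k + 1 => m k * Mseq m k

/-- The Vilenkin group `G_m = ∏_k ℤ_{m_k}`. -/
abbrev Gm (m : ℕ → ℕ) : Type := (k : ℕ) → ZMod (m k)

/-- The `j`-th digit of `n` in the generalized number system based on `m`. -/
def digit (m : ℕ → ℕ) (n j : ℕ) : ℕ := n / Mseq m j % m j

/-- The generalized Rademacher functions `r_k(x) = exp(2πi x_k / m_k)`. -/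
def rad (m : ℕ → ℕ) (k : ℕ) (x : Gm m) : ℂ :=
  Complex.exp (2 * Real.pi * Complex.I * ((x k).val : ℂ) / (m k : ℂ))

/-- The Vilenkin system `ψ_n = ∏_k r_k^{n_k}`. -/
def psi (m : ℕ → ℕ) (n : ℕ) (x : Gm m) : ℂ := ∏ᶠ k : ℕ, rad m k x ^ digit m n k

/-- The Dirichlet kernels `D_n = ∑_{k<n} ψ_k`. -/
def Dker (m : ℕ → ℕ) (n : ℕ) (x : Gm m) : ℂ := ∑ k ∈ Finset.range n, psi m k x

/-- The interval `I_n(x)` : all `y` agreeing with `x` on the first `n` coordinates. -/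
def Iset (m : ℕ → ℕ) (n : ℕ) (x : Gm m) : Set (Gm m) := {y | ∀ k < n, y k = x k}

/-- `I_n := I_n(0)`. -/
def IsetO (m : ℕ → ℕ) (n : ℕ) : Set (Gm m) := Iset m n 0

/-- `μ` is the normalized Haar (product) measure iff every interval `I_n(x)` has
measure `1 / M_n`. -/
def IsHaarGm (m : ℕ → ℕ) (μ : Measure (Gm m)) : Prop :=
  ∀ n x, μ (Iset m n x) = ((Mseq m n : ℝ≥0∞))⁻¹

/-- The σ-algebra `F_n` generated by the intervals `{I_n(x)}`, i.e. by the first `n`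
coordinates. -/
def filt (m : ℕ → ℕ) (n : ℕ) : MeasurableSpace (Gm m) :=
  MeasurableSpace.comap (fun x (k : Fin n) => x k) ⊤

/-- A (Vilenkin) martingale with respect to the filtration `F_n`. -/
def IsVMartingale (m : ℕ → ℕ) (μ : Measure (Gm m)) (f : ℕ → Gm m → ℂ) : Prop :=
  (∀ n, Integrable (f n) μ) ∧
  (∀ n, Measurable[filt m n] (f n)) ∧
  (∀ n N, n ≤ N → μ[f N | filt m n] =ᵐ[μ] f n)

/-- Membership in the martingale Hardy space `H_p`: the maximal function
`f* = sup_n |f^{(n)}|` belongs to `L_p`. -/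
def MemHp (m : ℕ → ℕ) (μ : Measure (Gm m)) (p : ℝ) (f : ℕ → Gm m → ℂ) : Prop :=
  ∫⁻ x, (⨆ n, (‖f n x‖₊ : ℝ≥0∞)) ^ p ∂μ < ⊤

/-- The `i`-th Vilenkin–Fourier coefficient of an integrable function. -/
def fourierCoefFn (m : ℕ → ℕ) (μ : Measure (Gm m)) (g : Gm m → ℂ) (i : ℕ) : ℂ :=
  ∫ x, g x * (starRingEnd ℂ) (psi m i x) ∂μ

/-- The partial sum `S_n` built from a sequence `c` of Fourier coefficients. -/
def Spart (m : ℕ → ℕ) (c : ℕ → ℂ) (n : ℕ) (x : Gm m) : ℂ :=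
  ∑ k ∈ Finset.range n, c k * psi m k x

/-- The weak `L_{p,∞}` quasinorm `sup_{λ>0} λ μ(|g| > λ)^{1/p}`. -/
def wLp (m : ℕ → ℕ) (μ : Measure (Gm m)) (p : ℝ) (g : Gm m → ℂ) : ℝ≥0∞ :=
  ⨆ (t : ℝ) (_ : 0 < t), ENNReal.ofReal t * μ {x | t < ‖g x‖} ^ (1 / p)

/-- `|n| = max {j : n_j ≠ 0}`. -/
def maxDigit (m : ℕ → ℕ) (n : ℕ) : ℕ := sSup {j | digit m n j ≠ 0}

/-- The set `ℕ_{n_0}` of positive integers with `n_0 = n_{|n|} = 1`. -/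
def Nn0 (m : ℕ → ℕ) : Set ℕ :=
  {n | 0 < n ∧ digit m n 0 = 1 ∧ digit m n (maxDigit m n) = 1}

/-- The atom `a = (M_α^{1/p-1}/M) (D_{M_{α+1}} - D_{M_α})`. -/
def atomFun (m : ℕ → ℕ) (MM : ℕ) (p : ℝ) (a : ℕ) (x : Gm m) : ℂ :=
  (((Mseq m a : ℝ) ^ (1 / p - 1) / (MM : ℝ) : ℝ) : ℂ) *
    (Dker m (Mseq m (a + 1)) x - Dker m (Mseq m a) x)

/-- The coefficients `λ_k = Φ_{M_{α_k}}^{-1/4}`. -/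
def lamSeq (m : ℕ → ℕ) (Φ : ℕ → ℝ) (α : ℕ → ℕ) (k : ℕ) : ℝ :=
  Φ (Mseq m (α k)) ^ (-(1 / 4 : ℝ))

/-- The martingale `f^{(A)} = ∑_{k : α_k < A} λ_k a_k` of the counterexample construction. -/
def fCon (m : ℕ → ℕ) (MM : ℕ) (p : ℝ) (Φ : ℕ → ℝ) (α : ℕ → ℕ) (A : ℕ) (x : Gm m) : ℂ :=
  ∑ᶠ (k : ℕ) (_ : α k < A), (lamSeq m Φ α k : ℂ) * atomFun m MM p (α k) x

lemma Mseq_pos {m : ℕ → ℕ} (hm : ∀ k, 2 ≤ m k) (k : ℕ) : 0 < Mseq m k := by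
  induction k with
  | zero => exact Nat.one_pos
  | succ k ih => exact Nat.mul_pos (by have := hm k; omega) ih

lemma Mseq_strictMono {m : ℕ → ℕ} (hm : ∀ k, 2 ≤ m k) : StrictMono (Mseq m) := by
  refine strictMono_nat_of_lt_succ fun k => ?_
  have h := Mseq_pos hm k
  have := hm k
  change Mseq m k < m k * Mseq m k
  nlinarith

lemma digit_eq_zero {m : ℕ → ℕ} (hm : ∀ k, 2 ≤ m k) {n N k : ℕ} (hn : n < Mseq m N)
    (hk : N ≤ k) : digit m n k = 0 := by
  have h : n < Mseq m k := hn.trans_le ((Mseq_strictMono hm).monotone hk)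
  simp [digit, Nat.div_eq_of_lt h]

lemma mod_Mseq_eq_of_digit_eq {m : ℕ → ℕ} {n i : ℕ} (N : ℕ)
    (h : ∀ k < N, digit m n k = digit m i k) : n % Mseq m N = i % Mseq m N := by
  induction N with
  | zero => simp [Mseq, Nat.mod_one]
  | succ N ih =>
    have h1 := ih fun k hk => h k (hk.trans N.lt_succ_self)
    have h2 := h N N.lt_succ_self
    unfold digit at h2
    change n % (m N * Mseq m N) = i % (m N * Mseq m N)
    rw [mul_comm, Nat.mod_mul, Nat.mod_mul, h1, h2]

lemma exists_digit_ne {m : ℕ → ℕ} {n i N : ℕ} (hn : n < Mseq m N)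
    (hi : i < Mseq m N) (hne : n ≠ i) : ∃ k < N, digit m n k ≠ digit m i k := by
  by_contra! h
  have := mod_Mseq_eq_of_digit_eq N h
  rw [Nat.mod_eq_of_lt hn, Nat.mod_eq_of_lt hi] at this
  exact hne this

lemma norm_rad (m : ℕ → ℕ) (k : ℕ) (x : Gm m) : ‖rad m k x‖ = 1 := by
  have : rad m k x = Complex.exp (((2 * Real.pi * ((x k).val : ℝ) / (m k : ℝ) : ℝ) : ℂ) *
      Complex.I) := by
    unfold rad
    congr 1
    push_cast
    ring
  rw [this, Complex.norm_exp_ofReal_mul_I]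

lemma psi_eq_prod {m : ℕ → ℕ} (hm : ∀ k, 2 ≤ m k) {n N : ℕ} (hn : n < Mseq m N) (x : Gm m) :
    psi m n x = ∏ k : Fin N, rad m k x ^ digit m n k := by
  rw [Fin.prod_univ_eq_prod_range (fun k => rad m k x ^ digit m n k) N]
  refine finprod_eq_prod_of_mulSupport_subset _ fun k hk => ?_
  by_contra h
  simp only [coe_range, Set.mem_Iio, not_lt] at h
  simp [digit_eq_zero hm hn h] at hk

/-- The root of unity attached to a residue class. -/
def zmodChar (n : ℕ) (a : ZMod n) : ℂ :=
  Complex.exp (2 * Real.pi * Complex.I / (n : ℂ)) ^ a.val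

lemma rad_eq_zmodChar (m : ℕ → ℕ) (k : ℕ) (x : Gm m) : rad m k x = zmodChar (m k) (x k) := by
  rw [rad, zmodChar, ← Complex.exp_nat_mul]
  congr 1
  ring

lemma sum_zmod_val {n : ℕ} [NeZero n] (f : ℕ → ℂ) :
    ∑ a : ZMod n, f a.val = ∑ a ∈ Finset.range n, f a := by
  refine Finset.sum_nbij ZMod.val (fun a _ => Finset.mem_range.2 (ZMod.val_lt a))
    (ZMod.val_injective n).injOn (fun a ha => ?_) fun _ _ => rfl
  exact ⟨a, by simp, ZMod.val_natCast_of_lt (Finset.mem_range.1 ha)⟩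

lemma sum_zmodChar_eq_zero {n : ℕ} [NeZero n] {d e : ℕ} (hd : d < n) (he : e < n)
    (hde : d ≠ e) :
    ∑ a : ZMod n, zmodChar n a ^ d * (starRingEnd ℂ) (zmodChar n a ^ e) = 0 := by
  set ζ := Complex.exp (2 * Real.pi * Complex.I / (n : ℂ)) with hζ
  have hprim : IsPrimitiveRoot ζ n := Complex.isPrimitiveRoot_exp n (NeZero.ne n)
  have hnorm : ‖ζ‖ = 1 := hprim.norm'_eq_one (NeZero.ne n)
  have hconj : ζ * (starRingEnd ℂ) ζ = 1 := by
    rw [Complex.mul_conj, Complex.normSq_eq_norm_sq, hnorm]; simp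
  set w := ζ ^ d * (starRingEnd ℂ) ζ ^ e with hw
  have hwn : w ^ n = 1 := by
    rw [hw, mul_pow, ← pow_mul, ← pow_mul, mul_comm d, mul_comm e, pow_mul, pow_mul, ← map_pow,
      hprim.pow_eq_one]
    simp
  have hw1 : w ≠ 1 := by
    intro h
    refine hde (hprim.pow_inj hd he ?_)
    calc ζ ^ d = ζ ^ d * (ζ * (starRingEnd ℂ) ζ) ^ e := by rw [hconj]; simp
      _ = w * ζ ^ e := by rw [hw]; ring
      _ = ζ ^ e := by rw [h, one_mul]
  calc ∑ a : ZMod n, zmodChar n a ^ d * (starRingEnd ℂ) (zmodChar n a ^ e)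
      = ∑ a : ZMod n, w ^ a.val := by
        refine Finset.sum_congr rfl fun a _ => ?_
        simp only [zmodChar, ← hζ, map_pow, hw]
        ring
    _ = ∑ a ∈ Finset.range n, w ^ a := sum_zmod_val _
    _ = 0 := by
        have := mul_neg_geom_sum w n
        rw [hwn, sub_self] at this
        exact (mul_eq_zero.1 this).resolve_left (sub_ne_zero.2 hw1.symm)

/-- Restriction to the first `N` coordinates. -/
def restr (m : ℕ → ℕ) (N : ℕ) (x : Gm m) (k : Fin N) : ZMod (m k) := x k

lemma measurable_restr (m : ℕ → ℕ) (N : ℕ) : Measurable (restr m N) :=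
  measurable_pi_iff.2 fun k => measurable_pi_apply (k : ℕ)

lemma IsHaarGm.isProbabilityMeasure {m : ℕ → ℕ} {μ : Measure (Gm m)} (hμ : IsHaarGm m μ) :
    IsProbabilityMeasure μ := by
  refine ⟨?_⟩
  have h := hμ 0 0
  simpa [Iset, Mseq] using h

lemma integrable_comp_restr {m : ℕ → ℕ} (hm : ∀ k, 2 ≤ m k) {μ : Measure (Gm m)}
    (hμ : IsHaarGm m μ) (N : ℕ) (F : ((k : Fin N) → ZMod (m k)) → ℂ) :
    Integrable (fun x => F (restr m N x)) μ := by
  have : ∀ k, NeZero (m k) := fun k => ⟨by have := hm k; omega⟩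
  have := hμ.isProbabilityMeasure
  have : IsFiniteMeasure (μ.map (restr m N)) := inferInstance
  have h : Integrable F (μ.map (restr m N)) := Integrable.of_finite
  exact h.comp_measurable (measurable_restr m N)

lemma integral_comp_restr {m : ℕ → ℕ} [∀ k, NeZero (m k)] {μ : Measure (Gm m)}
    (hμ : IsHaarGm m μ) (N : ℕ) (F : ((k : Fin N) → ZMod (m k)) → ℂ) :
    ∫ x, F (restr m N x) ∂μ = (Mseq m N : ℂ)⁻¹ * ∑ y, F y := by
  have := hμ.isProbabilityMeasure
  have h : Integrable F (μ.map (restr m N)) := Integrable.of_finite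
  rw [← integral_map (measurable_restr m N).aemeasurable h.aestronglyMeasurable,
    integral_fintype h, Finset.mul_sum]
  refine Finset.sum_congr rfl fun y _ => ?_
  have hset : restr m N ⁻¹' {y} =
      Iset m N (fun k => if hk : k < N then y ⟨k, hk⟩ else 0) := by
    ext x
    simp only [Set.mem_preimage, Set.mem_singleton_iff, Iset, Set.mem_ofPred_eq, funext_iff, restr]
    refine ⟨fun hx k hk => ?_, fun hx k => ?_⟩
    · simpa [hk] using hx ⟨k, hk⟩
    · simpa using hx k k.2
  rw [Measure.real, Measure.map_apply (measurable_restr m N) (measurableSet_singleton y), hset,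
    hμ]
  simp

lemma psi_mul_conj_psi {m : ℕ → ℕ} (hm : ∀ k, 2 ≤ m k) {n i N : ℕ} (hn : n < Mseq m N)
    (hi : i < Mseq m N) (x : Gm m) :
    psi m n x * (starRingEnd ℂ) (psi m i x) =
      ∏ k : Fin N, zmodChar (m k) (restr m N x k) ^ digit m n k *
        (starRingEnd ℂ) (zmodChar (m k) (restr m N x k) ^ digit m i k) := by
  rw [psi_eq_prod hm hn, psi_eq_prod hm hi, map_prod, ← Finset.prod_mul_distrib]
  exact Finset.prod_congr rfl fun k _ => by rw [rad_eq_zmodChar, restr]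

lemma exists_lt_Mseq {m : ℕ → ℕ} (hm : ∀ k, 2 ≤ m k) (n i : ℕ) :
    ∃ N, n < Mseq m N ∧ i < Mseq m N := by
  refine ⟨max n i + 1, ?_, ?_⟩ <;>
  have := (Mseq_strictMono hm).id_le (max n i + 1) <;>
  simp only [id_eq] at this <;> omega

lemma integrable_psi_mul_conj_psi {m : ℕ → ℕ} (hm : ∀ k, 2 ≤ m k) {μ : Measure (Gm m)}
    (hμ : IsHaarGm m μ) (n i : ℕ) :
    Integrable (fun x => psi m n x * (starRingEnd ℂ) (psi m i x)) μ := by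
  obtain ⟨N, hn, hi⟩ := exists_lt_Mseq hm n i
  simp_rw [psi_mul_conj_psi hm hn hi]
  exact integrable_comp_restr hm hμ N fun y => ∏ k : Fin N, zmodChar (m k) (y k) ^ digit m n k *
        (starRingEnd ℂ) (zmodChar (m k) (y k) ^ digit m i k)

/-- The Vilenkin system is orthonormal. -/
lemma fourierCoefFn_psi {m : ℕ → ℕ} (hm : ∀ k, 2 ≤ m k) {μ : Measure (Gm m)}
    (hμ : IsHaarGm m μ) (n i : ℕ) :
    fourierCoefFn m μ (psi m n) i = if n = i then 1 else 0 := by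
  have : ∀ k, NeZero (m k) := fun k => ⟨by have := hm k; omega⟩
  have := hμ.isProbabilityMeasure
  obtain ⟨N, hn, hi⟩ := exists_lt_Mseq hm n i
  unfold fourierCoefFn
  split_ifs with h
  · subst h
    have h1 : ∀ x, psi m n x * (starRingEnd ℂ) (psi m n x) = 1 := fun x => by
      rw [Complex.mul_conj, Complex.normSq_eq_norm_sq, psi_eq_prod hm hn, norm_prod]
      simp [norm_rad]
    simp [h1]
  · simp_rw [psi_mul_conj_psi hm hn hi]
    rw [integral_comp_restr hμ N fun y => ∏ k : Fin N, zmodChar (m k) (y k) ^ digit m n k *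
        (starRingEnd ℂ) (zmodChar (m k) (y k) ^ digit m i k)]
    obtain ⟨k, hk, hne⟩ := exists_digit_ne hn hi h
    have := Finset.prod_univ_sum (fun k : Fin N => (Finset.univ : Finset (ZMod (m k))))
      fun k a => zmodChar (m k) a ^ digit m n k * (starRingEnd ℂ) (zmodChar (m k) a ^ digit m i k)
    rw [Fintype.piFinset_univ] at this
    rw [← this, Finset.prod_eq_zero (Finset.mem_univ (⟨k, hk⟩ : Fin N)), mul_zero]
    have hpos : 0 < m k := by have := hm k; omega
    exact sum_zmodChar_eq_zero (Nat.mod_lt _ hpos) (Nat.mod_lt _ hpos) hne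

lemma fourierCoefFn_sum {m : ℕ → ℕ} {μ : Measure (Gm m)} {ι : Type*} (s : Finset ι)
    (b : ι → ℂ) (g : ι → Gm m → ℂ) (i : ℕ)
    (hg : ∀ k ∈ s, Integrable (fun x => g k x * (starRingEnd ℂ) (psi m i x)) μ) :
    fourierCoefFn m μ (fun x => ∑ k ∈ s, b k * g k x) i =
      ∑ k ∈ s, b k * fourierCoefFn m μ (g k) i := by
  simp only [fourierCoefFn, Finset.sum_mul, mul_assoc]
  rw [integral_finsetSum _ fun k hk => (hg k hk).const_mul _]
  simp only [integral_const_mul]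

lemma atomFun_eq_sum {m : ℕ → ℕ} (hm : ∀ k, 2 ≤ m k) (MM : ℕ) (p : ℝ) (a : ℕ) (x : Gm m) :
    atomFun m MM p a x = ∑ n ∈ Finset.Ico (Mseq m a) (Mseq m (a + 1)),
      (((Mseq m a : ℝ) ^ (1 / p - 1) / (MM : ℝ) : ℝ) : ℂ) * psi m n x := by
  rw [atomFun, Dker, Dker, ← Finset.sum_Ico_eq_sub _ ((Mseq_strictMono hm).monotone a.le_succ),
    Finset.mul_sum]

lemma integrable_atomFun_mul_conj_psi {m : ℕ → ℕ} (hm : ∀ k, 2 ≤ m k) {μ : Measure (Gm m)}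
    (hμ : IsHaarGm m μ) (MM : ℕ) (p : ℝ) (a i : ℕ) :
    Integrable (fun x => atomFun m MM p a x * (starRingEnd ℂ) (psi m i x)) μ := by
  simp only [atomFun_eq_sum hm, Finset.sum_mul, mul_assoc]
  exact integrable_finsetSum _ fun n _ => (integrable_psi_mul_conj_psi hm hμ n i).const_mul _

lemma fourierCoefFn_atomFun {m : ℕ → ℕ} (hm : ∀ k, 2 ≤ m k) {μ : Measure (Gm m)}
    (hμ : IsHaarGm m μ) (MM : ℕ) (p : ℝ) (a i : ℕ) :
    fourierCoefFn m μ (atomFun m MM p a) i =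
      if i ∈ Finset.Ico (Mseq m a) (Mseq m (a + 1)) then
        (((Mseq m a : ℝ) ^ (1 / p - 1) / (MM : ℝ) : ℝ) : ℂ) else 0 := by
  rw [funext (atomFun_eq_sum hm MM p a),
    fourierCoefFn_sum _ _ _ _ fun n _ => integrable_psi_mul_conj_psi hm hμ n i]
  simp only [fourierCoefFn_psi hm hμ, mul_ite, mul_one, mul_zero]
  rw [Finset.sum_ite_eq']

lemma fourierCoefFn_fCon {m : ℕ → ℕ} (hm : ∀ k, 2 ≤ m k) {μ : Measure (Gm m)}
    (hμ : IsHaarGm m μ) (MM : ℕ) (p : ℝ) (Φ : ℕ → ℝ) {α : ℕ → ℕ} (hα : StrictMono α)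
    {A l i : ℕ} (hA : α l < A) (hi : i ∈ Finset.Ico (Mseq m (α l)) (Mseq m (α l + 1))) :
    fourierCoefFn m μ (fCon m MM p Φ α A) i =
      (lamSeq m Φ α l : ℂ) * (((Mseq m (α l) : ℝ) ^ (1 / p - 1) / (MM : ℝ) : ℝ) : ℂ) := by
  have hfin : {k | α k < A}.Finite :=
    (Set.finite_Iio A).subset fun k hk => (hα.id_le k).trans_lt hk
  have hf : fCon m MM p Φ α A =
      fun x => ∑ k ∈ hfin.toFinset, (lamSeq m Φ α k : ℂ) * atomFun m MM p (α k) x :=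
    funext fun x => finsum_mem_eq_finite_toFinset_sum _ hfin
  rw [hf, fourierCoefFn_sum _ _ _ _ fun k _ => integrable_atomFun_mul_conj_psi hm hμ MM p (α k) i,
    Finset.sum_eq_single l]
  · rw [fourierCoefFn_atomFun hm hμ, if_pos hi]
  · intro k _ hkl
    rw [fourierCoefFn_atomFun hm hμ, if_neg, mul_zero]
    rw [Finset.mem_Ico] at hi ⊢
    rintro ⟨h1, h2⟩
    have h3 := (Mseq_strictMono hm).lt_iff_lt.1 (h1.trans_lt hi.2)
    have h4 := (Mseq_strictMono hm).lt_iff_lt.1 (hi.1.trans_lt h2)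
    exact hkl (hα.injective (by omega))
  · intro h
    exact absurd (hfin.mem_toFinset.2 hA) h

lemma mul_Mseq_mem_Ico {m : ℕ → ℕ} (hm : ∀ k, 2 ≤ m k) {a j : ℕ}
    (hj : j ∈ Finset.Ico 1 (m a)) :
    j * Mseq m a ∈ Finset.Ico (Mseq m a) (Mseq m (a + 1)) := by
  rw [Finset.mem_Ico] at hj ⊢
  exact ⟨Nat.le_mul_of_pos_left _ hj.1, Nat.mul_lt_mul_of_pos_right hj.2 (Mseq_pos hm a)⟩

lemma rpow_weight_mul_sq {M F K p : ℝ} (hM : 0 < M) (hF : 0 < F) :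
    M ^ (2 - 2 / p) * F * (F ^ (-(1 / 4 : ℝ)) * (M ^ (1 / p - 1) / K)) ^ 2 =
      (K ^ 2)⁻¹ * F ^ ((1 : ℝ) / 2) := by
  have h1 : M ^ (2 - 2 / p) * (M ^ (1 / p - 1)) ^ 2 = 1 := by
    rw [← Real.rpow_natCast, ← Real.rpow_mul hM.le, ← Real.rpow_add hM]
    rw [show 2 - 2 / p + (1 / p - 1) * ((2 : ℕ) : ℝ) = 0 by push_cast; ring, Real.rpow_zero]
  have h2 : F * (F ^ (-(1 / 4 : ℝ))) ^ 2 = F ^ ((1 : ℝ) / 2) := by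
    rw [← Real.rpow_natCast, ← Real.rpow_mul hF.le]
    nth_rewrite 1 [← Real.rpow_one F]
    rw [← Real.rpow_add hF]
    norm_num
  calc _ = (M ^ (2 - 2 / p) * (M ^ (1 / p - 1)) ^ 2) * (F * (F ^ (-(1 / 4 : ℝ))) ^ 2) *
        (K ^ 2)⁻¹ := by ring
    _ = _ := by rw [h1, h2]; ring

theorem statement13 (m : ℕ → ℕ) (hm : ∀ k, 2 ≤ m k)
    (MM : ℕ) (hMM : IsLUB (Set.range m) MM)
    (μ : Measure (Gm m)) (hμ : IsHaarGm m μ)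
    (p : ℝ) (hp0 : 0 < p) (hp1 : p ≤ 1)
    (Φ : ℕ → ℝ) (hΦpos : ∀ n, 0 < Φ n) (hΦmono : Monotone Φ)
    (hΦtop : Tendsto Φ atTop atTop)
    (α : ℕ → ℕ) (hα : StrictMono α) (hα2 : ∀ k, 2 ≤ α k)
    (hsum : Summable fun k => Φ (Mseq m (α k)) ^ (-(p / 4) : ℝ))
    (c : ℕ → ℂ)
    (hc : ∀ i, Tendsto (fun k => fourierCoefFn m μ (fCon m MM p Φ α k) i) atTop (nhds (c i))) :
    (∃ C : ℝ, 0 < C ∧ ∀ k : ℕ,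
      C * Φ (Mseq m (α k)) ^ ((1 : ℝ) / 2) ≤
        ∑ l ∈ Finset.range (k + 1), (Mseq m (α l) : ℝ) ^ (2 - 2 / p) * Φ (Mseq m (α l)) *
          ∑ j ∈ Finset.Ico 1 (m (α l)), ‖c (j * Mseq m (α l))‖ ^ 2) ∧
    ∑' l : ℕ, ENNReal.ofReal ((Mseq m (α l) : ℝ) ^ (2 - 2 / p) * Φ (Mseq m (α l)) *
      ∑ j ∈ Finset.Ico 1 (m (α l)), ‖c (j * Mseq m (α l))‖ ^ 2) = ⊤ := by
  have hMM0 : (0 : ℝ) < MM := by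
    have h1 := hMM.1 ⟨0, rfl⟩
    have h2 := hm 0
    exact_mod_cast (show 0 < MM by omega)
  have hC : (0 : ℝ) < ((MM : ℝ) ^ 2)⁻¹ := by positivity
  have hcoef : ∀ l, ∀ j ∈ Finset.Ico 1 (m (α l)), ‖c (j * Mseq m (α l))‖ =
      Φ (Mseq m (α l)) ^ (-(1 / 4 : ℝ)) * ((Mseq m (α l) : ℝ) ^ (1 / p - 1) / MM) := by
    intro l j hj
    have hlim : c (j * Mseq m (α l)) = (lamSeq m Φ α l : ℂ) *
        (((Mseq m (α l) : ℝ) ^ (1 / p - 1) / (MM : ℝ) : ℝ) : ℂ) := by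
      refine tendsto_nhds_unique (hc _) (tendsto_const_nhds.congr' ?_)
      filter_upwards [eventually_gt_atTop (α l)] with A hA
      exact (fourierCoefFn_fCon hm hμ MM p Φ hα hA (mul_Mseq_mem_Ico hm hj)).symm
    have hΦ := hΦpos (Mseq m (α l))
    rw [hlim, norm_mul, Complex.norm_real, Complex.norm_real, lamSeq,
      Real.norm_of_nonneg (by positivity), Real.norm_of_nonneg (by positivity)]
  have hnonneg : ∀ l, 0 ≤ (Mseq m (α l) : ℝ) ^ (2 - 2 / p) * Φ (Mseq m (α l)) *
      ∑ j ∈ Finset.Ico 1 (m (α l)), ‖c (j * Mseq m (α l))‖ ^ 2 := by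
    intro l
    have hΦ := hΦpos (Mseq m (α l))
    positivity
  have hterm : ∀ l, ((MM : ℝ) ^ 2)⁻¹ * Φ (Mseq m (α l)) ^ ((1 : ℝ) / 2) ≤
      (Mseq m (α l) : ℝ) ^ (2 - 2 / p) * Φ (Mseq m (α l)) *
        ∑ j ∈ Finset.Ico 1 (m (α l)), ‖c (j * Mseq m (α l))‖ ^ 2 := by
    intro l
    have hΦ := hΦpos (Mseq m (α l))
    have h1 : 1 ∈ Finset.Ico 1 (m (α l)) := Finset.mem_Ico.2 ⟨le_rfl, hm _⟩
    rw [← rpow_weight_mul_sq (p := p) (Nat.cast_pos.2 (Mseq_pos hm (α l))) hΦ, ← hcoef l 1 h1]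
    refine mul_le_mul_of_nonneg_left ?_ (by positivity)
    exact Finset.single_le_sum (f := fun j => ‖c (j * Mseq m (α l))‖ ^ 2)
      (fun j _ => by positivity) h1
  refine ⟨⟨_, hC, fun k => (hterm k).trans ?_⟩, ?_⟩
  · exact Finset.single_le_sum (f := fun l => (Mseq m (α l) : ℝ) ^ (2 - 2 / p) *
      Φ (Mseq m (α l)) * ∑ j ∈ Finset.Ico 1 (m (α l)), ‖c (j * Mseq m (α l))‖ ^ 2)
      (fun l _ => hnonneg l) (Finset.self_mem_range_succ k)
  · have htop : Tendsto (fun l => ENNReal.ofReal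
        (((MM : ℝ) ^ 2)⁻¹ * Φ (Mseq m (α l)) ^ ((1 : ℝ) / 2))) atTop (nhds ⊤) := by
      refine ENNReal.tendsto_ofReal_atTop.comp (Tendsto.const_mul_atTop hC ?_)
      exact (tendsto_rpow_atTop (by norm_num)).comp
        (hΦtop.comp ((Mseq_strictMono hm).comp hα).tendsto_atTop)
    refine top_le_iff.1 (le_of_tendsto' htop fun l => ?_)
    exact (ENNReal.ofReal_le_ofReal (hterm l)).trans (ENNReal.le_tsum l)

end VilenkinPaper
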